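/- arXiv:math/0608799 — 2 statements merged into one kernel-verified Lean document; each statement's English description precedes it below -/
import Mathlib

section
/- For all natural numbers u ≥ 4 and v ≥ 2, h(uv+1) − u·h(v) ≥ (u+1)/2; equivalently, 2·(h(uv+1) − u·h(v)) ≥ u + 1. -/
/-- `binOnes n` is the number of 1s in the binary expansion of `n`. -/
def binOnes (n : ℕ) : ℕ := (Nat.digits 2 n).count 1

/-- `h n = ⌈n/2⌉ - b n`, regarded as an integer. -/
def hFun (n : ℕ) : ℤ := (((n + 1) / 2 : ℕ) : ℤ) - (binOnes n : ℤ)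

theorem binOnes_zero : binOnes 0 = 0 := by simp [binOnes]

theorem binOnes_two_mul (n : ℕ) : binOnes (2 * n) = binOnes n := by
  rcases Nat.eq_zero_or_pos n with rfl | hn
  · rfl
  · simp [binOnes, Nat.digits_def' (b := 2) (n := 2 * n) (by omega) (by omega)]

theorem binOnes_two_mul_add_one (n : ℕ) : binOnes (2 * n + 1) = binOnes n + 1 := by
  have h₁ : (2 * n + 1) % 2 = 1 := by omega
  have h₂ : (2 * n + 1) / 2 = n := by omega
  simp [binOnes, h₁, h₂]

theorem binOnes_add_one_le (n : ℕ) : binOnes (n + 1) ≤ binOnes n + 1 := by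
  induction n using Nat.strong_induction_on with
  | _ n ih =>
    obtain ⟨k, rfl | rfl⟩ := Nat.even_or_odd' n
    · rw [binOnes_two_mul_add_one, binOnes_two_mul]
    · rw [show 2 * k + 1 + 1 = 2 * (k + 1) by ring, binOnes_two_mul, binOnes_two_mul_add_one]
      have := ih k (by omega)
      omega

theorem binOnes_add_le (m n : ℕ) : binOnes (m + n) ≤ binOnes m + binOnes n := by
  induction m using Nat.strong_induction_on generalizing n with
  | _ m ih =>
    rcases Nat.eq_zero_or_pos m with rfl | hm
    · simp
    obtain ⟨a, rfl | rfl⟩ := Nat.even_or_odd' m <;> obtain ⟨c, rfl | rfl⟩ := Nat.even_or_odd' n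
    · rw [← mul_add]
      simpa only [binOnes_two_mul] using ih a (by omega) c
    · rw [← add_assoc, ← mul_add]
      have := ih a (by omega) c
      simp only [binOnes_two_mul, binOnes_two_mul_add_one]
      omega
    · rw [show 2 * a + 1 + 2 * c = 2 * (a + c) + 1 by ring]
      have := ih a (by omega) c
      simp only [binOnes_two_mul, binOnes_two_mul_add_one]
      omega
    · rw [show 2 * a + 1 + (2 * c + 1) = 2 * (a + (c + 1)) by ring]
      have h₁ := ih a (by omega) (c + 1)
      have h₂ := binOnes_add_one_le c
      simp only [binOnes_two_mul, binOnes_two_mul_add_one]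
      omega

theorem binOnes_mul_le (m n : ℕ) : binOnes (m * n) ≤ binOnes m * binOnes n := by
  induction m using Nat.strong_induction_on with
  | _ m ih =>
    rcases Nat.eq_zero_or_pos m with rfl | hm
    · simp [binOnes_zero]
    obtain ⟨k, rfl | rfl⟩ := Nat.even_or_odd' m
    · rw [mul_assoc, binOnes_two_mul, binOnes_two_mul]
      exact ih k (by omega)
    · rw [add_mul, one_mul, mul_assoc, binOnes_two_mul_add_one, add_mul, one_mul]
      have h₁ := binOnes_add_le (2 * (k * n)) n
      have h₂ := ih k (by omega)
      rw [binOnes_two_mul] at h₁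
      omega

theorem binOnes_pos {n : ℕ} (hn : 0 < n) : 0 < binOnes n := by
  induction n using Nat.strong_induction_on with
  | _ n ih =>
    obtain ⟨k, rfl | rfl⟩ := Nat.even_or_odd' n
    · rw [binOnes_two_mul]
      exact ih k (by omega) (by omega)
    · rw [binOnes_two_mul_add_one]
      omega

theorem two_mul_binOnes_lt {n : ℕ} (hn : 4 ≤ n) : 2 * binOnes n < n := by
  induction n using Nat.strong_induction_on with
  | _ n ih =>
    rcases Nat.lt_or_ge n 8 with h | h
    · interval_cases n <;> simp [binOnes]
    obtain ⟨k, rfl | rfl⟩ := Nat.even_or_odd' n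
    · have := ih k (by omega) (by omega)
      rw [binOnes_two_mul]
      omega
    · have := ih k (by omega) (by omega)
      rw [binOnes_two_mul_add_one]
      omega

theorem hFun_mul_add_one (u v : ℕ) (hu : 4 ≤ u) (hv : 2 ≤ v) :
    (u : ℤ) + 1 ≤ 2 * (hFun (u * v + 1) - (u : ℤ) * hFun v) := by
  have hb := (binOnes_add_one_le (u * v)).trans (Nat.add_le_add_right (binOnes_mul_le u v) 1)
  have hu' := two_mul_binOnes_lt hu
  unfold hFun
  obtain ⟨k, rfl | rfl⟩ := Nat.even_or_odd' v
  · have h₁ : (u * (2 * k) + 1 + 1) / 2 = u * k + 1 := by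
      rw [show u * (2 * k) + 1 + 1 = 2 * (u * k + 1) by ring]
      omega
    have h₂ : (2 * k + 1) / 2 = k := by omega
    have hpos : 0 < binOnes (2 * k) := binOnes_pos (by omega)
    rw [h₁, h₂]
    generalize binOnes (u * (2 * k) + 1) = c at *
    generalize binOnes (2 * k) = b at *
    generalize binOnes u = a at *
    zify at *
    nlinarith [mul_nonneg (by linarith : (0 : ℤ) ≤ u - a) (by linarith : (0 : ℤ) ≤ b - 1)]
  · have h₁ : u * (2 * k + 1) + 1 ≤ 2 * ((u * (2 * k + 1) + 1 + 1) / 2) := by omega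
    have h₂ : (2 * k + 1 + 1) / 2 = k + 1 := by omega
    have hpos : 2 ≤ binOnes (2 * k + 1) := by
      rw [binOnes_two_mul_add_one]
      have : 0 < binOnes k := binOnes_pos (by omega)
      omega
    rw [h₂]
    generalize (u * (2 * k + 1) + 1 + 1) / 2 = d at *
    generalize binOnes (u * (2 * k + 1) + 1) = c at *
    generalize binOnes (2 * k + 1) = b at *
    generalize binOnes u = a at *
    zify at *
    nlinarith [mul_nonneg (by linarith : (0 : ℤ) ≤ u - a) (by linarith : (0 : ℤ) ≤ b - 2)]
end

section
/- Let G be a finite connected cubic simple graph. Then there exists an edge f of G whose orbit O(f) under Aut(G) has minimal cardinality among all edge orbits, and such that O(f) is either the entire edge set of G, or a disjoint union of stars (a partition of O(f) into triples, each triple consisting of the three edges incident to some common vertex, with distinct triples sharing no vertex), or a matching (a set of pairwise non-adjacent edges). -/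
/-- The orbit of an edge `e` (as an element of `Sym2 V`) under the action of
the automorphism group of `G`. -/
def edgeOrbit {V : Type} (G : SimpleGraph V) (e : Sym2 V) : Set (Sym2 V) :=
  {f | ∃ φ : G ≃g G, Sym2.map φ e = f}

open SimpleGraph

section OrbitGraph

variable {V : Type} {G : SimpleGraph V}

/-- The spanning subgraph of `G` whose edges are those in the orbit of `e`. -/
def orbitGraph (G : SimpleGraph V) (e : Sym2 V) : SimpleGraph V :=
  SimpleGraph.fromEdgeSet (edgeOrbit G e)

theorem self_mem_edgeOrbit (e : Sym2 V) : e ∈ edgeOrbit G e :=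
  ⟨RelIso.refl _, by simp⟩

theorem map_mem_edgeSet (φ : G ≃g G) {e : Sym2 V} (he : e ∈ G.edgeSet) :
    Sym2.map φ e ∈ G.edgeSet := by
  induction e with | _ a b
  simpa [φ.map_adj_iff] using he

theorem map_mem_edgeOrbit (φ : G ≃g G) {e f : Sym2 V} (hf : f ∈ edgeOrbit G e) :
    Sym2.map φ f ∈ edgeOrbit G e := by
  obtain ⟨ψ, rfl⟩ := hf
  exact ⟨ψ.trans φ, by simp [Sym2.map_map]⟩

theorem mem_edgeOrbit_symm {e f : Sym2 V} (hf : f ∈ edgeOrbit G e) : e ∈ edgeOrbit G f := by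
  obtain ⟨ψ, rfl⟩ := hf
  refine ⟨ψ.symm, ?_⟩
  induction e with | _ a b
  simp

theorem map_mem_edgeOrbit_iff (φ : G ≃g G) {e f : Sym2 V} :
    Sym2.map φ f ∈ edgeOrbit G e ↔ f ∈ edgeOrbit G e := by
  refine ⟨fun h => ?_, map_mem_edgeOrbit φ⟩
  have := map_mem_edgeOrbit φ.symm h
  induction f with | _ a b
  simpa using this

theorem edgeOrbit_subset_edgeSet {e : Sym2 V} (he : e ∈ G.edgeSet) :
    edgeOrbit G e ⊆ G.edgeSet := by
  rintro _ ⟨φ, rfl⟩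
  exact map_mem_edgeSet φ he

theorem orbitGraph_adj {e : Sym2 V} (he : e ∈ G.edgeSet) {v w : V} :
    (orbitGraph G e).Adj v w ↔ s(v, w) ∈ edgeOrbit G e := by
  simp only [orbitGraph, fromEdgeSet_adj, and_iff_left_iff_imp]
  exact fun h => G.ne_of_adj (edgeOrbit_subset_edgeSet he h)

theorem edgeSet_orbitGraph {e : Sym2 V} (he : e ∈ G.edgeSet) :
    (orbitGraph G e).edgeSet = edgeOrbit G e := by
  ext f
  induction f with | _ a b
  exact orbitGraph_adj he

theorem orbitGraph_le {e : Sym2 V} (he : e ∈ G.edgeSet) : orbitGraph G e ≤ G :=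
  fun _ _ h => edgeOrbit_subset_edgeSet he ((orbitGraph_adj he).1 h)

/-- The number of edges in the orbit of `e` that are incident to `v`. -/
noncomputable def orbitDegree (G : SimpleGraph V) (e : Sym2 V) (v : V) : ℕ :=
  ((orbitGraph G e).neighborSet v).ncard

theorem orbitDegree_map {e : Sym2 V} (he : e ∈ G.edgeSet) (φ : G ≃g G) (v : V) :
    orbitDegree G e (φ v) = orbitDegree G e v := by
  have : (orbitGraph G e).neighborSet (φ v) = φ '' (orbitGraph G e).neighborSet v := by
    ext w
    obtain ⟨w, rfl⟩ := φ.surjective w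
    simp only [mem_neighborSet, orbitGraph_adj he, φ.injective.mem_set_image]
    exact map_mem_edgeOrbit_iff φ (f := s(v, w))
  rw [orbitDegree, this, Set.ncard_image_of_injective _ φ.injective, orbitDegree]

theorem orbitDegree_endpoints {a b x y : V} (hab : G.Adj a b)
    (hxy : s(x, y) ∈ edgeOrbit G s(a, b)) :
    (orbitDegree G s(a, b) x = orbitDegree G s(a, b) a ∧
      orbitDegree G s(a, b) y = orbitDegree G s(a, b) b) ∨
    (orbitDegree G s(a, b) x = orbitDegree G s(a, b) b ∧
      orbitDegree G s(a, b) y = orbitDegree G s(a, b) a) := by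
  obtain ⟨φ, h⟩ := hxy
  rw [Sym2.map_mk, Sym2.eq_iff] at h
  rcases h with ⟨rfl, rfl⟩ | ⟨rfl, rfl⟩
  · exact .inl ⟨orbitDegree_map hab φ a, orbitDegree_map hab φ b⟩
  · exact .inr ⟨orbitDegree_map hab φ b, orbitDegree_map hab φ a⟩

variable [Fintype V]

theorem sum_orbitDegree {e : Sym2 V} (he : e ∈ G.edgeSet) :
    ∑ v, orbitDegree G e v = 2 * (edgeOrbit G e).ncard := by
  classical
  rw [← edgeSet_orbitGraph he, Set.ncard_eq_toFinset_card', ← SimpleGraph.edgeFinset,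
    ← sum_degrees_eq_twice_card_edges]
  refine Finset.sum_congr rfl fun v _ => ?_
  rw [orbitDegree, Set.ncard_eq_toFinset_card']
  rfl

theorem orbitDegree_le (hcubic : ∀ v : V, (G.neighborSet v).ncard = 3) {e : Sym2 V}
    (he : e ∈ G.edgeSet) (v : V) : orbitDegree G e v ≤ 3 := by
  rw [← hcubic v]
  exact Set.ncard_le_ncard (fun _ h => orbitGraph_le he h)

theorem orbitDegree_pos {e : Sym2 V} (he : e ∈ G.edgeSet) {v w : V}
    (h : s(v, w) ∈ edgeOrbit G e) : 0 < orbitDegree G e v :=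
  (Set.ncard_pos).2 ⟨w, (orbitGraph_adj he).2 h⟩

theorem mem_edgeOrbit_of_orbitDegree_eq_three
    (hcubic : ∀ v : V, (G.neighborSet v).ncard = 3) {e : Sym2 V} (he : e ∈ G.edgeSet) {v w : V}
    (hv : orbitDegree G e v = 3) (hvw : G.Adj v w) : s(v, w) ∈ edgeOrbit G e := by
  have : (orbitGraph G e).neighborSet v = G.neighborSet v :=
    Set.eq_of_subset_of_ncard_le (fun _ h => orbitGraph_le he h)
      (by rw [hcubic v, ← hv, orbitDegree])
  exact (orbitGraph_adj he).1 (this.symm ▸ hvw : w ∈ (orbitGraph G e).neighborSet v)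

theorem eq_of_orbitDegree_eq_one {e : Sym2 V} (he : e ∈ G.edgeSet) {v w w' : V}
    (hv : orbitDegree G e v = 1) (hw : s(v, w) ∈ edgeOrbit G e)
    (hw' : s(v, w') ∈ edgeOrbit G e) : w = w' :=
  (Set.ncard_le_one_iff (Set.toFinite _)).1 hv.le ((orbitGraph_adj he).2 hw) ((orbitGraph_adj he).2 hw')

/-- An orbit inducing degree two at `v` comes with another orbit, that of the remaining edge
at `v`, having at most one edge for every vertex where the degree is two. -/
theorem exists_edgeOrbit_ncard_le (hcubic : ∀ v : V, (G.neighborSet v).ncard = 3) {e : Sym2 V}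
    (he : e ∈ G.edgeSet) {v : V} (hv : orbitDegree G e v = 2) :
    ∃ t ∈ G.edgeSet, v ∈ t ∧ t ∉ edgeOrbit G e ∧
      (edgeOrbit G t).ncard ≤ {w | orbitDegree G e w = 2}.ncard := by
  have key : ∀ x, ∃ y, orbitDegree G e x = 2 →
      G.neighborSet x \ (orbitGraph G e).neighborSet x = {y} := by
    intro x
    by_cases hx : orbitDegree G e x = 2
    · have := Set.ncard_sdiff_add_ncard_of_subset
        (show (orbitGraph G e).neighborSet x ⊆ G.neighborSet x from fun _ h => orbitGraph_le he h)
      rw [hcubic x, ← orbitDegree, hx] at this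
      obtain ⟨y, hy⟩ := Set.ncard_eq_one.1 (Nat.add_right_cancel this : _ = 1)
      exact ⟨y, fun _ => hy⟩
    · exact ⟨x, fun h => absurd h hx⟩
  choose g hg using key
  have hgv : g v ∈ G.neighborSet v \ (orbitGraph G e).neighborSet v := by simp [hg v hv]
  have hvO : s(v, g v) ∉ edgeOrbit G e := fun h => hgv.2 ((orbitGraph_adj he).2 h)
  refine ⟨s(v, g v), hgv.1, Sym2.mem_mk_left _ _, hvO, ?_⟩
  refine (Set.ncard_le_ncard ?_).trans
    (Set.ncard_image_le (f := fun x => s(x, g x)) (s := {w | orbitDegree G e w = 2}))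
  rintro _ ⟨φ, rfl⟩
  have hφv : orbitDegree G e (φ v) = 2 := by rw [orbitDegree_map he, hv]
  refine ⟨φ v, hφv, ?_⟩
  have : φ (g v) ∈ G.neighborSet (φ v) \ (orbitGraph G e).neighborSet (φ v) := by
    refine ⟨φ.map_adj_iff.2 hgv.1, fun h => hvO ?_⟩
    exact (map_mem_edgeOrbit_iff φ).1 ((orbitGraph_adj he).1 h)
  rw [hg _ hφv, Set.mem_singleton_iff] at this
  simp [this]

/-- A minimal orbit inducing degree two at one vertex induces degree zero or two everywhere. -/
theorem orbitDegree_eq_zero_or_two {e : Sym2 V} (he : e ∈ G.edgeSet)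
    (hle : (edgeOrbit G e).ncard ≤ {w | orbitDegree G e w = 2}.ncard) :
    {w | orbitDegree G e w = 2}.ncard = (edgeOrbit G e).ncard ∧
      ∀ w, orbitDegree G e w = 0 ∨ orbitDegree G e w = 2 := by
  classical
  have hsum := sum_orbitDegree he
  rw [← Finset.sum_filter_add_sum_filter_not _ (fun w => orbitDegree G e w = 2),
    Finset.sum_congr rfl (fun w hw => (Finset.mem_filter.1 hw).2), Finset.sum_const,
    smul_eq_mul] at hsum
  have hcard : {w | orbitDegree G e w = 2}.ncard =
      (Finset.univ.filter fun w => orbitDegree G e w = 2).card := by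
    rw [← Set.ncard_coe_finset]
    simp
  rw [hcard] at hle ⊢
  have hzero : ∑ w with ¬ orbitDegree G e w = 2, orbitDegree G e w = 0 := by omega
  refine ⟨by omega, fun w => ?_⟩
  by_contra! h
  exact h.1 (Finset.sum_eq_zero_iff.1 hzero w (by simpa using h.2))

/-- The trichotomy for orbits that induce degree two at no vertex. -/
theorem edgeOrbit_trichotomy (hconn : G.Connected)
    (hcubic : ∀ v : V, (G.neighborSet v).ncard = 3) {e : Sym2 V} (he : e ∈ G.edgeSet)
    (h2 : ∀ v, orbitDegree G e v ≠ 2) :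
    edgeOrbit G e = G.edgeSet ∨
      (∃ S : Set V,
        edgeOrbit G e = {f' | f' ∈ G.edgeSet ∧ ∃ v ∈ S, v ∈ f'} ∧
        ∀ v ∈ S, ∀ w ∈ S, v ≠ w →
          Disjoint (insert v (G.neighborSet v)) (insert w (G.neighborSet w))) ∨
      (∀ f₁ ∈ edgeOrbit G e, ∀ f₂ ∈ edgeOrbit G e, f₁ ≠ f₂ →
        ∀ v : V, v ∈ f₁ → v ∈ f₂ → False) := by
  have hdeg : ∀ v w, s(v, w) ∈ edgeOrbit G e →
      orbitDegree G e v = 1 ∨ orbitDegree G e v = 3 := by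
    intro v w hvw
    have := orbitDegree_le hcubic he v
    have := orbitDegree_pos he hvw
    have := h2 v
    omega
  induction e with | _ a b
  have ha := hdeg a b (self_mem_edgeOrbit _)
  have hb := hdeg b a (Sym2.eq_swap ▸ self_mem_edgeOrbit _)
  have hends {x y : V} := orbitDegree_endpoints (a := a) (b := b) (x := x) (y := y) he
  by_cases h33 : orbitDegree G s(a, b) a = 3 ∧ orbitDegree G s(a, b) b = 3
  · left
    have hall : ∀ v, orbitDegree G s(a, b) v = 3 := by
      intro v
      induction (reachable_iff_reflTransGen a v).1 (hconn.preconnected a v) with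
      | refl => exact h33.1
      | tail _ hxy ih =>
        have := hends (mem_edgeOrbit_of_orbitDegree_eq_three hcubic he ih hxy)
        omega
    refine (edgeOrbit_subset_edgeSet he).antisymm fun f hf => ?_
    induction f with | _ x y
    exact mem_edgeOrbit_of_orbitDegree_eq_three hcubic he (hall x) hf
  by_cases h11 : orbitDegree G s(a, b) a = 1 ∧ orbitDegree G s(a, b) b = 1
  · right; right
    rintro f₁ hf₁ f₂ hf₂ hne v ⟨x, rfl⟩ ⟨y, rfl⟩
    have := hends hf₁
    exact hne (by rw [eq_of_orbitDegree_eq_one he (by omega) hf₁ hf₂])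
  right; left
  have h13 {x y : V} (hxy : s(x, y) ∈ edgeOrbit G s(a, b)) :
      (orbitDegree G s(a, b) x = 1 ∧ orbitDegree G s(a, b) y = 3) ∨
      (orbitDegree G s(a, b) x = 3 ∧ orbitDegree G s(a, b) y = 1) := by
    have := hends hxy
    omega
  refine ⟨{v | orbitDegree G s(a, b) v = 3}, ?_, ?_⟩
  · ext f
    constructor
    · intro hf
      refine ⟨edgeOrbit_subset_edgeSet he hf, ?_⟩
      induction f with | _ x y
      rcases h13 hf with h | h
      · exact ⟨y, h.2, Sym2.mem_mk_right _ _⟩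
      · exact ⟨x, h.1, Sym2.mem_mk_left _ _⟩
    · rintro ⟨hf, v, hv, w, rfl⟩
      exact mem_edgeOrbit_of_orbitDegree_eq_three hcubic he hv hf
  · have hmem {v w : V} (hv : orbitDegree G s(a, b) v = 3) (hvw : G.Adj v w) :
        s(w, v) ∈ edgeOrbit G s(a, b) ∧ orbitDegree G s(a, b) w = 1 := by
      have h := mem_edgeOrbit_of_orbitDegree_eq_three hcubic he hv hvw
      have := h13 h
      exact ⟨by rwa [Sym2.eq_swap (a := w)], by omega⟩
    intro v (hv : _ = 3) w (hw : _ = 3) hne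
    rw [Set.disjoint_left]
    rintro x (rfl | hx) (rfl | hx')
    · exact hne rfl
    · have := (hmem hw hx').2
      omega
    · have := (hmem hv hx).2
      omega
    · exact hne (eq_of_orbitDegree_eq_one he (hmem hv hx).2 (hmem hv hx).1 (hmem hw hx').1)

theorem exists_minimal_edgeOrbit (hne : G.edgeSet.Nonempty) :
    ∃ e ∈ G.edgeSet, ∀ f ∈ G.edgeSet, (edgeOrbit G e).ncard ≤ (edgeOrbit G f).ncard :=
  Set.exists_min_image _ _ (Set.toFinite _) hne

end OrbitGraph

theorem exists_well_chosen_minimal_orbit {V : Type} [Fintype V]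
    (G : SimpleGraph V) (hconn : G.Connected)
    (hcubic : ∀ v : V, (G.neighborSet v).ncard = 3) :
    ∃ f ∈ G.edgeSet,
      -- the orbit of `f` has minimal cardinality among all edge orbits
      (∀ f' ∈ G.edgeSet, (edgeOrbit G f).ncard ≤ (edgeOrbit G f').ncard) ∧
      -- and it is the whole edge set, a disjoint union of stars, or a matching
      (edgeOrbit G f = G.edgeSet ∨
        (∃ S : Set V,
          edgeOrbit G f = {f' | f' ∈ G.edgeSet ∧ ∃ v ∈ S, v ∈ f'} ∧
          ∀ v ∈ S, ∀ w ∈ S, v ≠ w →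
            Disjoint (insert v (G.neighborSet v)) (insert w (G.neighborSet w))) ∨
        (∀ f₁ ∈ edgeOrbit G f, ∀ f₂ ∈ edgeOrbit G f, f₁ ≠ f₂ →
          ∀ v : V, v ∈ f₁ → v ∈ f₂ → False)) := by
  obtain ⟨v⟩ := hconn.nonempty
  obtain ⟨w, hw⟩ := (Set.ncard_pos (s := G.neighborSet v)).1 (by simp [hcubic v])
  obtain ⟨e, he, hmin⟩ := exists_minimal_edgeOrbit ⟨s(v, w), hw⟩
  by_cases h2 : ∀ v, orbitDegree G e v ≠ 2
  · exact ⟨e, he, hmin, edgeOrbit_trichotomy hconn hcubic he h2⟩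
  push Not at h2
  obtain ⟨x, hx⟩ := h2
  obtain ⟨t, ht, hxt, hte, hcard⟩ := exists_edgeOrbit_ncard_le hcubic he hx
  rw [(orbitDegree_eq_zero_or_two he ((hmin t ht).trans hcard)).1] at hcard
  have hmin' : ∀ f ∈ G.edgeSet, (edgeOrbit G t).ncard ≤ (edgeOrbit G f).ncard :=
    fun f hf => hcard.trans (hmin f hf)
  refine ⟨t, ht, hmin', edgeOrbit_trichotomy hconn hcubic ht fun y hy => ?_⟩
  obtain ⟨u, hu, -, -, hucard⟩ := exists_edgeOrbit_ncard_le hcubic ht hy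
  have hdeg := (orbitDegree_eq_zero_or_two ht ((hmin' u hu).trans hucard)).2 x
  obtain ⟨z, rfl⟩ := hxt
  have hpos := orbitDegree_pos ht (self_mem_edgeOrbit s(x, z))
  have hdisj : Disjoint ((orbitGraph G e).neighborSet x)
      ((orbitGraph G s(x, z)).neighborSet x) := by
    rw [Set.disjoint_left]
    intro y hy hy'
    obtain ⟨φ, hφ⟩ := mem_edgeOrbit_symm ((orbitGraph_adj ht).1 hy')
    exact hte (hφ ▸ map_mem_edgeOrbit φ ((orbitGraph_adj he).1 hy))
  have hle : orbitDegree G e x + orbitDegree G s(x, z) x ≤ 3 := by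
    rw [orbitDegree, orbitDegree, ← Set.ncard_union_eq hdisj, ← hcubic x]
    exact Set.ncard_le_ncard
      (Set.union_subset (fun _ h => orbitGraph_le he h) (fun _ h => orbitGraph_le ht h))
  omega
end
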